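/- Let n ≥ 2, let β ≥ 0, and let Ω ⊆ ℝ^n be a bounded open convex set with nonempty interior. Let B ⊆ ℝ^n be the open ball centered at the origin with V(B) = V(Ω). Then (n V(Ω) + β P(Ω)) / W(Ω) ≤ (n V(B) + β P(B)) / W(B); explicitly, (n V(Ω) + β P(Ω))/W(Ω) ≤ ω_n^{2/n} · [ n V(Ω)^{(n-2)/n} / P(Ω^♯) + β V(Ω)^{-2/n} ] where Ω^♯ = B. This is the geometric inequality underlying the isoperimetric bound for the first Wentzell eigenvalue: the ball maximizes the Wentzell eigenvalue bound among convex sets of prescribed volume. -/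

import Mathlib

open MeasureTheory Metric Set Real Bornology

noncomputable section

/-- Volume (Lebesgue measure) of a set in `ℝⁿ`. -/
def vol (n : ℕ) (Ω : Set (EuclideanSpace ℝ (Fin n))) : ℝ :=
  (volume Ω).toReal

/-- Surface area: the `(n-1)`-dimensional Hausdorff measure of the topological boundary. -/
def perim (n : ℕ) (Ω : Set (EuclideanSpace ℝ (Fin n))) : ℝ :=
  (μH[(n : ℝ) - 1] (frontier Ω)).toReal

/-- Boundary momentum `W(Ω) = ∫_{∂Ω} |x|² dH^{n-1}(x)`. -/
def bmom (n : ℕ) (Ω : Set (EuclideanSpace ℝ (Fin n))) : ℝ :=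
  ∫ x in frontier Ω, ‖x‖ ^ 2 ∂μH[(n : ℝ) - 1]

/-- The scale invariant functional `λ(Ω) = W(Ω) / (P(Ω) V(Ω)^{2/n})`. -/
def lamFun (n : ℕ) (Ω : Set (EuclideanSpace ℝ (Fin n))) : ℝ :=
  bmom n Ω / (perim n Ω * vol n Ω ^ ((2 : ℝ) / n))

/-- `ω_n`: the Lebesgue measure of the unit ball of `ℝⁿ`. -/
def unitBallVol (n : ℕ) : ℝ :=
  (volume (ball (0 : EuclideanSpace ℝ (Fin n)) 1)).toReal

section UniformMeasure
open Filter Topology ENNReal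

variable {X : Type*} [PseudoMetricSpace X] [MeasurableSpace X] [BorelSpace X]

lemma lintegral_measure_inter_ball_eq [SecondCountableTopology X] (μ ν : Measure X)
    [SFinite μ] [SFinite ν] (U : Set X) (hU : MeasurableSet U) (r : ℝ) :
    ∫⁻ x, ν (U ∩ ball x r) ∂μ = ∫⁻ y in U, μ (ball y r) ∂ν := by
  have hs : MeasurableSet {p : X × X | p.2 ∈ U ∧ dist p.2 p.1 < r} :=
    (hU.preimage measurable_snd).inter
      (measurableSet_lt (measurable_snd.dist measurable_fst) measurable_const)
  have h1 := Measure.prod_apply (μ := μ) (ν := ν) hs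
  have h2 := Measure.prod_apply_symm (μ := μ) (ν := ν) hs
  rw [h1] at h2
  calc _ = _ := h2
    _ = ∫⁻ y, U.indicator (fun y => μ (ball y r)) y ∂ν := by
      refine lintegral_congr fun y => ?_
      by_cases hy : y ∈ U
      · simp only [indicator_of_mem hy]
        congr 1
        ext x
        simp [hy, dist_comm]
      · simp [hy]
    _ = _ := lintegral_indicator hU _

/-- Comparison of two measures giving all balls of equal radius the same mass, on open sets. -/
lemma measure_isOpen_le_mul_of_tendsto [SecondCountableTopology X] {μ ν : Measure X}
    [IsFiniteMeasure μ] [IsFiniteMeasure ν] {g h : ℝ → ℝ≥0∞}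
    (hμ : ∀ x r, μ (ball x r) = g r) (hν : ∀ x r, ν (ball x r) = h r)
    (h0 : ∀ r, 0 < r → h r ≠ 0) (ht : ∀ r, h r ≠ ∞)
    {u : ℕ → ℝ} (hu0 : ∀ k, 0 < u k) (hu : Tendsto u atTop (𝓝 0))
    {c : ℝ≥0∞} (hc : Tendsto (fun k => g (u k) / h (u k)) atTop (𝓝 c))
    {U : Set X} (hU : IsOpen U) : μ U ≤ c * ν U := by
  have hm : ∀ k, Measurable fun x => ν (U ∩ ball x (u k)) := by
    intro k
    have hs : MeasurableSet {p : X × X | p.2 ∈ U ∧ dist p.2 p.1 < u k} :=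
      (hU.measurableSet.preimage measurable_snd).inter
        (measurableSet_lt (measurable_snd.dist measurable_fst) measurable_const)
    exact measurable_measure_prodMk_left (ν := ν) hs
  have hlim : ∀ x ∈ U,
      Tendsto (fun k => ν (U ∩ ball x (u k)) / h (u k)) atTop (𝓝 1) := by
    intro x hx
    obtain ⟨ε, hε, hball⟩ := Metric.isOpen_iff.1 hU x hx
    refine tendsto_const_nhds.congr' ?_
    filter_upwards [hu.eventually (gt_mem_nhds hε)] with k hk
    rw [inter_eq_right.2 ((ball_subset_ball hk.le).trans hball), hν,
      ENNReal.div_self (h0 _ (hu0 k)) (ht _)]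
  have key : ∀ k, ∫⁻ x, ν (U ∩ ball x (u k)) / h (u k) ∂μ = g (u k) / h (u k) * ν U := by
    intro k
    simp_rw [div_eq_mul_inv]
    rw [lintegral_mul_const _ (hm k), lintegral_measure_inter_ball_eq _ _ _ hU.measurableSet]
    simp_rw [hμ]
    rw [setLIntegral_const]
    ring
  calc μ U = ∫⁻ x in U, 1 ∂μ := by simp
    _ ≤ ∫⁻ x in U, liminf (fun k => ν (U ∩ ball x (u k)) / h (u k)) atTop ∂μ := by
      refine setLIntegral_mono' hU.measurableSet fun x hx => ?_
      rw [(hlim x hx).liminf_eq]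
    _ ≤ ∫⁻ x, liminf (fun k => ν (U ∩ ball x (u k)) / h (u k)) atTop ∂μ :=
      setLIntegral_le_lintegral _ _
    _ ≤ liminf (fun k => ∫⁻ x, ν (U ∩ ball x (u k)) / h (u k) ∂μ) atTop :=
      lintegral_liminf_le fun k => (hm k).div_const _
    _ = c * ν U := by
      simp_rw [key]
      exact (ENNReal.Tendsto.mul_const hc (Or.inr (measure_ne_top _ _))).liminf_eq

/-- Two nonzero finite measures on a separable metric space, each giving all balls of equal
radius the same mass, are proportional. -/
lemma exists_eq_smul_of_measure_ball_eq [SecondCountableTopology X] (μ ν : Measure X)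
    [IsFiniteMeasure μ] [IsFiniteMeasure ν] [NeZero μ] [NeZero ν]
    (hμ : ∀ x y r, μ (ball x r) = μ (ball y r)) (hν : ∀ x y r, ν (ball x r) = ν (ball y r)) :
    ∃ c : ℝ≥0∞, c ≠ 0 ∧ c ≠ ∞ ∧ μ = c • ν := by
  have pos : ∀ (m : Measure X) [NeZero m], (∀ x y r, m (ball x r) = m (ball y r)) →
      ∀ x r, 0 < r → m (ball x r) ≠ 0 := by
    intro m _ hm x r hr h0
    refine NeZero.ne m (Measure.measure_univ_eq_zero.1 ?_)
    refine measure_null_of_locally_null _ fun y _ => ⟨ball y r, ?_, ?_⟩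
    · exact mem_nhdsWithin_of_mem_nhds (ball_mem_nhds y hr)
    · rw [hm y x, h0]
  have hne : Nonempty X := by
    by_contra hX
    rw [not_nonempty_iff] at hX
    exact NeZero.ne μ (Measure.eq_zero_of_isEmpty μ)
  obtain ⟨x₀⟩ := hne
  obtain ⟨c, φ, hφ, hc⟩ := CompactSpace.tendsto_subseq
    (fun k : ℕ => μ (ball x₀ (1 / ((k : ℝ) + 1))) / ν (ball x₀ (1 / ((k : ℝ) + 1))))
  set u : ℕ → ℝ := fun k => 1 / ((φ k : ℝ) + 1)
  have hu0 : ∀ k, 0 < u k := fun k => by positivity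
  have hu : Tendsto u atTop (𝓝 0) :=
    tendsto_one_div_add_atTop_nhds_zero_nat.comp hφ.tendsto_atTop
  have hc' : Tendsto (fun k => ν (ball x₀ (u k)) / μ (ball x₀ (u k))) atTop (𝓝 c⁻¹) := by
    refine (tendsto_inv_iff.2 hc).congr fun k => ?_
    exact ENNReal.inv_div (Or.inl (measure_ne_top _ _)) (Or.inl (pos ν hν _ _ (hu0 k)))
  have le1 : ∀ U : Set X, IsOpen U → μ U ≤ c * ν U := fun U hU =>
    measure_isOpen_le_mul_of_tendsto (g := fun r => μ (ball x₀ r)) (h := fun r => ν (ball x₀ r))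
      (fun x r => hμ x x₀ r) (fun x r => hν x x₀ r) (fun r hr => pos ν hν _ _ hr)
      (fun r => measure_ne_top _ _) hu0 hu hc hU
  have le2 : ∀ U : Set X, IsOpen U → ν U ≤ c⁻¹ * μ U := fun U hU =>
    measure_isOpen_le_mul_of_tendsto (g := fun r => ν (ball x₀ r)) (h := fun r => μ (ball x₀ r))
      (fun x r => hν x x₀ r) (fun x r => hμ x x₀ r) (fun r hr => pos μ hμ _ _ hr)
      (fun r => measure_ne_top _ _) hu0 hu hc' hU
  have c0 : c ≠ 0 := by
    rintro rfl
    have := le1 univ isOpen_univ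
    simp only [zero_mul, nonpos_iff_eq_zero, Measure.measure_univ_eq_zero] at this
    exact NeZero.ne μ this
  have ct : c ≠ ∞ := by
    rintro rfl
    have := le2 univ isOpen_univ
    simp only [inv_top, zero_mul, nonpos_iff_eq_zero, Measure.measure_univ_eq_zero] at this
    exact NeZero.ne ν this
  have : IsFiniteMeasure (c • ν) := Measure.smul_finite ν ct
  refine ⟨c, c0, ct, Measure.OuterRegular.ext_isOpen fun U hU => ?_⟩
  refine le_antisymm (le1 U hU) ?_
  rw [Measure.smul_apply, smul_eq_mul]
  calc c * ν U ≤ c * (c⁻¹ * μ U) := by gcongr; exact le2 U hU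
    _ = μ U := by rw [← mul_assoc, ENNReal.mul_inv_cancel c0 ct, one_mul]

end UniformMeasure

section HausdorffSphere
open scoped ENNReal NNReal Pointwise

lemma hausdorffMeasure_le_of_dist_le {X Y : Type*} [MetricSpace X] [MeasurableSpace X]
    [BorelSpace X] [MetricSpace Y] [MeasurableSpace Y] [BorelSpace Y] {d : ℝ} (hd : 0 ≤ d)
    {f : Y → X} {A : Set X} {B : Set Y} (hf : MapsTo f B A)
    (hdist : ∀ b ∈ B, ∀ c ∈ B, dist b c ≤ dist (f b) (f c)) : μH[d] B ≤ μH[d] A := by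
  have hanti : AntilipschitzWith 1 fun b : B => f b :=
    AntilipschitzWith.of_le_mul_dist fun b c => by
      simpa [Subtype.dist_eq] using hdist b b.2 c c.2
  calc μH[d] B = μH[d] (Subtype.val '' (univ : Set B)) := by simp
    _ = μH[d] (univ : Set B) := isometry_subtype_coe.hausdorffMeasure_image (Or.inl hd) _
    _ ≤ (1 : ℝ≥0) ^ d * μH[d] ((fun b : B => f b) '' univ) :=
      hanti.le_hausdorffMeasure_image hd _
    _ = μH[d] ((fun b : B => f b) '' univ) := by simp
    _ ≤ μH[d] A := measure_mono (by rintro _ ⟨b, -, rfl⟩; exact hf b.2)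

/-- Pushing points of a sphere outwards along rays does not decrease distances. -/
lemma dist_le_dist_smul_of_norm_eq {E : Type*} [NormedAddCommGroup E] [InnerProductSpace ℝ E]
    {x y : E} (hxy : ‖x‖ = ‖y‖) {s t : ℝ} (hs : 1 ≤ s) (ht : 1 ≤ t) :
    dist x y ≤ dist (s • x) (t • y) := by
  rw [dist_eq_norm, dist_eq_norm]
  refine le_of_sq_le_sq ?_ (norm_nonneg _)
  rw [norm_sub_sq_real, norm_sub_sq_real, norm_smul, norm_smul, inner_smul_left,
    inner_smul_right, mul_pow, mul_pow, hxy]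
  simp only [norm_eq_abs, sq_abs, conj_trivial]
  have h := real_inner_le_norm x y
  rw [hxy] at h
  have hst : 1 ≤ s * t := by nlinarith
  nlinarith [mul_nonneg (sub_nonneg.2 hst) (sub_nonneg.2 h),
    mul_nonneg (sq_nonneg (s - t)) (sq_nonneg ‖y‖)]

lemma hausdorffMeasure_sphere_lt_top (m : ℕ) :
    μH[(m : ℝ)] (sphere (0 : EuclideanSpace ℝ (Fin (m + 1))) 1) < ∞ := by
  let face : Fin (m + 1) → ℝ → (Fin m → ℝ) → EuclideanSpace ℝ (Fin (m + 1)) :=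
    fun i s y => WithLp.toLp 2 (i.insertNth s y : Fin (m + 1) → ℝ)
  let Q : Set (Fin m → ℝ) := Icc (-1) 1
  have hface : ∀ i s, μH[(m : ℝ)] (face i s '' Q) < ∞ := by
    intro i s
    have hins : LipschitzWith 1 fun y : Fin m → ℝ => (i.insertNth s y : Fin (m + 1) → ℝ) := by
      refine LipschitzWith.of_dist_le_mul fun y z => ?_
      rw [NNReal.coe_one, one_mul, dist_pi_le_iff dist_nonneg]
      intro j
      refine Fin.succAboveCases i ?_ (fun k => ?_) j
      · simp
      · simpa using dist_le_pi_dist y z k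
    obtain ⟨K, hK⟩ : ∃ K, LipschitzWith K (face i s) :=
      ⟨_, (PiLp.lipschitzWith_toLp 2 (fun _ : Fin (m + 1) => ℝ)).comp hins⟩
    refine (hK.hausdorffMeasure_image_le (Nat.cast_nonneg m) Q).trans_lt ?_
    have hvol : (μH[(m : ℝ)] : Measure (Fin m → ℝ)) = volume := by
      simpa using hausdorffMeasure_pi_real (ι := Fin m)
    rw [hvol]
    exact ENNReal.mul_lt_top (by simp) isCompact_Icc.measure_lt_top
  let F : Set (EuclideanSpace ℝ (Fin (m + 1))) := ⋃ i, (face i 1 '' Q ∪ face i (-1) '' Q)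
  have hF : μH[(m : ℝ)] F < ∞ := by
    refine (measure_iUnion_le _).trans_lt ?_
    rw [tsum_fintype]
    exact ENNReal.sum_lt_top.2 fun i _ =>
      (measure_union_le _ _).trans_lt (ENNReal.add_lt_top.2 ⟨hface i 1, hface i (-1)⟩)
  refine lt_of_le_of_lt (hausdorffMeasure_le_of_dist_le (Nat.cast_nonneg m)
    (f := fun x => ‖WithLp.ofLp x‖⁻¹ • x) (A := F) ?_ ?_) hF
  · intro x hx
    have hx0 : x ≠ 0 := by
      rintro rfl
      simp at hx
    have hx0' : WithLp.ofLp x ≠ 0 := by simpa using hx0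
    have hpos : 0 < ‖WithLp.ofLp x‖ := norm_pos_iff.2 hx0'
    obtain ⟨i, hi⟩ : ∃ i, ‖WithLp.ofLp x i‖ = ‖WithLp.ofLp x‖ := by
      obtain ⟨i, -, hi⟩ := Finset.exists_mem_eq_sup Finset.univ Finset.univ_nonempty
        (fun i => ‖WithLp.ofLp x i‖₊)
      exact ⟨i, by rw [← coe_nnnorm, ← coe_nnnorm, Pi.nnnorm_def, hi]⟩
    set z := ‖WithLp.ofLp x‖⁻¹ • x with hz
    have hzj : ∀ j, |z j| ≤ 1 := by
      intro j
      have : |x j| ≤ ‖WithLp.ofLp x‖ := norm_le_pi_norm (WithLp.ofLp x) j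
      simp only [hz, PiLp.smul_apply, smul_eq_mul, abs_mul, abs_inv, abs_of_pos hpos]
      rw [inv_mul_le_iff₀ hpos]
      simpa using this
    have hzi : |z i| = 1 := by
      simp only [hz, PiLp.smul_apply, smul_eq_mul, abs_mul, abs_inv, abs_of_pos hpos]
      rw [inv_mul_eq_one₀ hpos.ne']
      exact hi.symm
    have hzmem : ∀ s, z i = s → z ∈ face i s '' Q := by
      rintro s rfl
      refine ⟨i.removeNth (WithLp.ofLp z), ⟨fun j => (abs_le.1 (hzj _)).1,
        fun j => (abs_le.1 (hzj _)).2⟩, ?_⟩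
      simp only [face]
      ext j
      simp
    refine mem_iUnion.2 ⟨i, ?_⟩
    rcases eq_or_eq_neg_of_abs_eq hzi with h | h
    · exact Or.inl (hzmem _ h)
    · exact Or.inr (hzmem _ h)
  · intro x hx y hy
    have hge : ∀ x ∈ sphere (0 : EuclideanSpace ℝ (Fin (m + 1))) 1, 1 ≤ ‖WithLp.ofLp x‖⁻¹ := by
      intro x hx
      have hx1 : ‖x‖ = 1 := by simpa using hx
      have hx0' : WithLp.ofLp x ≠ 0 := by
        intro h
        have : x = 0 := by simpa using h
        simp [this] at hx1
      refine (one_le_inv₀ (norm_pos_iff.2 hx0')).2 ?_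
      refine (pi_norm_le_iff_of_nonneg zero_le_one).2 fun i => ?_
      rw [← hx1]
      exact PiLp.norm_apply_le x i
    refine dist_le_dist_smul_of_norm_eq ?_ (hge x hx) (hge y hy)
    rw [mem_sphere_zero_iff_norm.1 hx, mem_sphere_zero_iff_norm.1 hy]

lemma hausdorffMeasure_sphere_pos (m : ℕ) :
    0 < μH[(m : ℝ)] (sphere (0 : EuclideanSpace ℝ (Fin (m + 1))) 1) := by
  let D : Set (Fin m → ℝ) := {y | ∑ i, y i ^ 2 < 1}
  have hD : 0 < μH[(m : ℝ)] D := by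
    have hvol : (μH[(m : ℝ)] : Measure (Fin m → ℝ)) = volume := by
      simpa using hausdorffMeasure_pi_real (ι := Fin m)
    rw [hvol]
    refine IsOpen.measure_pos _ (isOpen_lt (by fun_prop) continuous_const) ⟨0, ?_⟩
    simp [D]
  refine hD.trans_le (hausdorffMeasure_le_of_dist_le (Nat.cast_nonneg m)
    (f := fun y => WithLp.toLp 2 (Fin.cons √(1 - ∑ i, y i ^ 2) y : Fin (m + 1) → ℝ)) ?_ ?_)
  · intro y hy
    have hy' : ∑ i, y i ^ 2 < 1 := hy
    rw [mem_sphere_zero_iff_norm, EuclideanSpace.norm_eq, Fin.sum_univ_succ]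
    simp only [Fin.cons_zero, Fin.cons_succ, norm_eq_abs, sq_abs]
    rw [sq_sqrt (by linarith)]
    simp
  · intro y _ z _
    refine (dist_pi_le_iff dist_nonneg).2 fun i => ?_
    have := PiLp.norm_apply_le (WithLp.toLp 2 (Fin.cons √(1 - ∑ i, y i ^ 2) y : Fin (m + 1) → ℝ)
      - WithLp.toLp 2 (Fin.cons √(1 - ∑ i, z i ^ 2) z : Fin (m + 1) → ℝ)) i.succ
    simpa [dist_eq_norm] using this

lemma hausdorffMeasure_sphere_inter (n : ℕ) {r : ℝ} (hr : 0 < r) (hn : 1 ≤ n)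
    (A : Set (EuclideanSpace ℝ (Fin n))) :
    μH[(n : ℝ) - 1] (sphere 0 r ∩ A) = ENNReal.ofReal (r ^ (n - 1)) *
      μH[(n : ℝ) - 1] {θ : sphere (0 : EuclideanSpace ℝ (Fin n)) 1 |
        r • (θ : EuclideanSpace ℝ (Fin n)) ∈ A} := by
  have hd : (0 : ℝ) ≤ (n : ℝ) - 1 := by
    have : (1 : ℝ) ≤ n := by exact_mod_cast hn
    linarith
  have hset : sphere 0 r ∩ A = r • ((↑) ''
      {θ : sphere (0 : EuclideanSpace ℝ (Fin n)) 1 | r • (θ : EuclideanSpace ℝ (Fin n)) ∈ A}) := by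
    ext x
    constructor
    · rintro ⟨hx, hxA⟩
      have hx' : ‖x‖ = r := by simpa using hx
      have hxr : r • r⁻¹ • x = x := by rw [smul_smul, mul_inv_cancel₀ hr.ne', one_smul]
      refine ⟨r⁻¹ • x, ⟨⟨r⁻¹ • x, ?_⟩, ?_, rfl⟩, hxr⟩
      · simp [norm_smul, hx', abs_of_pos hr, hr.ne']
      · simpa [hxr] using hxA
    · rintro ⟨_, ⟨θ, hθ, rfl⟩, rfl⟩
      refine ⟨?_, hθ⟩
      simp [norm_smul, abs_of_pos hr]
  rw [hset, Measure.hausdorffMeasure_smul₀ hd hr.ne',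
    isometry_subtype_coe.hausdorffMeasure_image (Or.inl hd)]
  have hcast : (n : ℝ) - 1 = ((n - 1 : ℕ) : ℝ) := by push_cast [hn]; ring
  have : ((‖r‖₊ ^ ((n : ℝ) - 1) : ℝ≥0) : ℝ≥0∞) = ENNReal.ofReal (r ^ (n - 1)) := by
    rw [hcast, NNReal.rpow_natCast, ENNReal.ofReal, Real.toNNReal_pow hr.le]
    congr 2
    ext
    simp [abs_of_pos hr, hr.le]
  rw [← this]
  rfl

lemma toSphere_ball_eq (n : ℕ) (x y : sphere (0 : EuclideanSpace ℝ (Fin n)) 1) (r : ℝ) :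
    (volume : Measure (EuclideanSpace ℝ (Fin n))).toSphere (ball x r) =
      (volume : Measure (EuclideanSpace ℝ (Fin n))).toSphere (ball y r) := by
  set L := (ℝ ∙ ((x : EuclideanSpace ℝ (Fin n)) - y))ᗮ.reflection
  have hL : L x = y := Submodule.reflection_sub (by simp)
  rw [Measure.toSphere_apply' _ measurableSet_ball, Measure.toSphere_apply' _ measurableSet_ball]
  congr 1
  have himg : Ioo (0 : ℝ) 1 • ((↑) '' ball x r : Set (EuclideanSpace ℝ (Fin n))) =
      L ⁻¹' (Ioo (0 : ℝ) 1 • ((↑) '' ball y r)) := by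
    ext z
    simp only [Set.mem_smul, mem_preimage, mem_image, mem_ball, Subtype.exists, exists_and_right,
      exists_eq_right]
    constructor
    · rintro ⟨t, ht, b, ⟨hb, hbx⟩, rfl⟩
      refine ⟨t, ht, L b, ⟨by simpa using hb, ?_⟩, by simp⟩
      rw [Subtype.dist_eq] at hbx ⊢
      rwa [← hL, L.dist_map]
    · rintro ⟨t, ht, b, ⟨hb, hby⟩, hz⟩
      refine ⟨t, ht, L.symm b, ⟨by simpa using hb, ?_⟩, ?_⟩
      · rw [Subtype.dist_eq] at hby ⊢
        rw [← L.dist_map, hL]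
        simpa using hby
      · rw [← map_smul, hz, L.symm_apply_apply]
  rw [himg]
  exact L.measurePreserving.measure_preimage_equiv (f := L.toHomeomorph.toMeasurableEquiv) _

lemma hausdorffMeasure_sphere_ball_eq (n : ℕ) {d : ℝ} (hd : 0 ≤ d)
    (x y : sphere (0 : EuclideanSpace ℝ (Fin n)) 1) (r : ℝ) :
    μH[d] (ball x r) = μH[d] (ball y r) := by
  set L := (ℝ ∙ ((x : EuclideanSpace ℝ (Fin n)) - y))ᗮ.reflection
  have hL : L x = y := Submodule.reflection_sub (by simp)
  have hball : ∀ z : sphere (0 : EuclideanSpace ℝ (Fin n)) 1,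
      μH[d] (((↑) : _ → EuclideanSpace ℝ (Fin n)) '' ball z r) = μH[d] (ball z r) := fun z =>
    isometry_subtype_coe.hausdorffMeasure_image (Or.inl hd) _
  rw [← hball x, ← hball y, ← L.isometry.hausdorffMeasure_image (Or.inl hd) ((↑) '' ball x r)]
  congr 1
  ext z
  simp only [mem_image, mem_ball, Subtype.exists, exists_and_right, exists_eq_right]
  constructor
  · rintro ⟨b, ⟨hb, hbx⟩, rfl⟩
    refine ⟨by simpa using hb, ?_⟩
    rw [Subtype.dist_eq] at hbx ⊢
    rwa [← hL, L.dist_map]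
  · rintro ⟨hb, hby⟩
    refine ⟨L.symm z, ⟨by simpa using hb, ?_⟩, by simp⟩
    rw [Subtype.dist_eq] at hby ⊢
    rw [← L.dist_map, hL]
    simpa using hby

/-- Polar coordinates with respect to the Hausdorff measures of spheres. -/
lemma exists_volume_eq_mul_lintegral_hausdorffMeasure_sphere (n : ℕ) (hn : 2 ≤ n) :
    ∃ κ : ℝ≥0∞, κ ≠ 0 ∧ κ ≠ ∞ ∧ ∀ A : Set (EuclideanSpace ℝ (Fin n)), MeasurableSet A →
      volume A = κ * ∫⁻ r in Ioi (0 : ℝ), μH[(n : ℝ) - 1] (sphere 0 r ∩ A) := by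
  obtain ⟨m, rfl⟩ : ∃ m, n = m + 1 := ⟨n - 1, by omega⟩
  have hm : ((m + 1 : ℕ) : ℝ) - 1 = m := by push_cast; ring
  set E := EuclideanSpace ℝ (Fin (m + 1))
  let σ : Measure (sphere (0 : E) 1) := μH[((m + 1 : ℕ) : ℝ) - 1]
  have hd : (0 : ℝ) ≤ ((m + 1 : ℕ) : ℝ) - 1 := by rw [hm]; positivity
  have hσ : σ univ = μH[(m : ℝ)] (sphere (0 : E) 1) := by
    rw [← isometry_subtype_coe.hausdorffMeasure_image (Or.inl hd), hm, image_univ,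
      Subtype.range_coe]
  have : IsFiniteMeasure σ := ⟨by rw [hσ]; exact hausdorffMeasure_sphere_lt_top m⟩
  have : NeZero σ := ⟨by
    rw [← Measure.measure_univ_ne_zero, hσ]
    exact (hausdorffMeasure_sphere_pos m).ne'⟩
  have : NeZero (volume : Measure E).toSphere := ⟨Measure.toSphere_ne_zero _⟩
  obtain ⟨κ, h0, ht, hκ⟩ := exists_eq_smul_of_measure_ball_eq (volume : Measure E).toSphere σ
    (toSphere_ball_eq _) (hausdorffMeasure_sphere_ball_eq _ hd)
  refine ⟨κ, h0, ht, fun A hA => ?_⟩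
  have hp := (volume : Measure E).measurePreserving_homeomorphUnitSphereProd
  let T : Set (sphere (0 : E) 1 × Ioi (0 : ℝ)) := {p | (p.2 : ℝ) • (p.1 : E) ∈ A}
  have hT : MeasurableSet T := by
    refine hA.preimage (Continuous.measurable ?_)
    fun_prop
  have hpre : homeomorphUnitSphereProd E ⁻¹' T = (↑) ⁻¹' A := by
    ext x
    have hx : ‖(x : E)‖ ≠ 0 := norm_ne_zero_iff.2 x.2
    simp [T, smul_smul, hx]
  have hA0 : volume A = (Measure.comap (↑) (volume : Measure E) : Measure ({0}ᶜ : Set E))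
      ((↑) ⁻¹' A) := by
    rw [comap_subtype_coe_apply (measurableSet_singleton _).compl, Subtype.image_preimage_coe,
      inter_comm, ← Set.sdiff_eq, measure_sdiff_null (measure_singleton _)]
  rw [hA0, ← hpre, hp.measure_preimage hT.nullMeasurableSet, Measure.prod_apply_symm hT, hκ,
    Measure.volumeIoiPow, lintegral_withDensity_eq_lintegral_mul₀]
  · simp only [Measure.smul_apply, smul_eq_mul, Pi.mul_apply]
    rw [← lintegral_const_mul' _ _ ht, ← lintegral_subtype_comap measurableSet_Ioi]
    refine lintegral_congr fun r => ?_
    rw [hausdorffMeasure_sphere_inter _ r.2 (by omega)]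
    rw [mul_left_comm]
    simp [E, T, σ]
  · fun_prop
  · exact (measurable_measure_prodMk_right hT).aemeasurable

end HausdorffSphere

section ConvexBoundary
open scoped ENNReal NNReal Pointwise

variable {E : Type*} [NormedAddCommGroup E] [InnerProductSpace ℝ E]

/-- Pushing two boundary points of a convex set along outer normals does not decrease their
distance. -/
lemma dist_le_dist_add_of_inner_nonneg {x y v w : E} (hv : 0 ≤ inner ℝ v (x - y))
    (hw : 0 ≤ inner ℝ w (y - x)) : dist x y ≤ dist (x + v) (y + w) := by
  rw [dist_eq_norm, dist_eq_norm]
  refine le_of_sq_le_sq ?_ (norm_nonneg _)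
  have h : x + v - (y + w) = (x - y) + (v - w) := by abel
  have h2 : inner ℝ (x - y) (v - w) = inner ℝ v (x - y) + inner ℝ w (y - x) := by
    rw [inner_sub_right, real_inner_comm v, real_inner_comm w, ← neg_sub x y, inner_neg_right]
    ring
  rw [h, norm_add_sq_real, h2]
  nlinarith [sq_nonneg ‖v - w‖]

/-- A boundary point of an open convex set inside a ball can be pushed along an outer normal to
the boundary of the ball. -/
lemma exists_outer_normal_norm_eq [CompleteSpace E] {Ω : Set E} (hop : IsOpen Ω)
    (hconv : Convex ℝ Ω) (hne : Ω.Nonempty) {x : E} (hx : x ∈ frontier Ω) {r : ℝ}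
    (hxr : ‖x‖ < r) :
    ∃ v : E, ‖x + v‖ = r ∧ x + v ∉ Ω ∧ ∀ y ∈ closure Ω, 0 ≤ inner ℝ v (x - y) := by
  have hxΩ : x ∉ Ω := by
    rw [hop.frontier_eq] at hx
    exact hx.2
  obtain ⟨f, hf⟩ := geometric_hahn_banach_open_point hconv hop hxΩ
  set ν := (InnerProductSpace.toDual ℝ E).symm f
  have hν : ∀ y, inner ℝ ν y = f y := fun y => InnerProductSpace.toDual_symm_apply
  have hν0 : ν ≠ 0 := by
    intro h
    obtain ⟨a, ha⟩ := hne
    have := hf a ha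
    rw [← hν, ← hν, h] at this
    simp at this
  have hνpos : 0 < ‖ν‖ := norm_pos_iff.2 hν0
  have hr : 0 < r := (norm_nonneg x).trans_lt hxr
  obtain ⟨t, ht, htr⟩ : ∃ t ∈ Icc (0 : ℝ) ((r + ‖x‖) / ‖ν‖), ‖x + t • ν‖ = r := by
    have hcont : ContinuousOn (fun t : ℝ => ‖x + t • ν‖) (Icc 0 ((r + ‖x‖) / ‖ν‖)) := by fun_prop
    refine intermediate_value_Icc (by positivity) hcont ⟨by simpa using hxr.le, ?_⟩
    have h1 : ‖((r + ‖x‖) / ‖ν‖) • ν‖ = r + ‖x‖ := by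
      rw [norm_smul, norm_eq_abs, abs_of_nonneg (by positivity), div_mul_cancel₀ _ hνpos.ne']
    have h2 := norm_sub_le (x + ((r + ‖x‖) / ‖ν‖) • ν) x
    rw [add_sub_cancel_left, h1] at h2
    linarith
  refine ⟨t • ν, htr, fun hmem => ?_, fun y hy => ?_⟩
  · have := hf _ hmem
    rw [map_add, map_smul, ← hν ν, real_inner_self_eq_norm_sq, smul_eq_mul] at this
    nlinarith [mul_nonneg ht.1 (sq_nonneg ‖ν‖)]
  · have hy' : f y ≤ f x := by
      have : closure Ω ⊆ {y | f y ≤ f x} :=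
        closure_minimal (fun a ha => (hf a ha).le) (isClosed_le f.continuous continuous_const)
      exact this hy
    rw [inner_smul_left, hν, map_sub]
    exact mul_nonneg ht.1 (by linarith)

lemma exists_smul_mem_frontier {Ω : Set E} {x : E} {a b : ℝ} (hab : a ≤ b) (ha : a • x ∈ Ω)
    (hb : b • x ∉ Ω) : ∃ s ∈ Icc a b, s • x ∈ frontier Ω := by
  have hpre : IsPreconnected ((fun s : ℝ => s • x) '' Icc a b) :=
    isPreconnected_Icc.image _ (by fun_prop)
  by_contra! hno
  obtain ⟨y, -, hy, hy'⟩ := hpre (interior Ω) (closure Ω)ᶜ isOpen_interior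
    isClosed_closure.isOpen_compl
    (by
      rintro _ ⟨s, hs, rfl⟩
      by_cases h : s • x ∈ closure Ω
      · exact Or.inl (by_contra fun h' => hno s hs ⟨h, h'⟩)
      · exact Or.inr h)
    ⟨_, ⟨a, left_mem_Icc.2 hab, rfl⟩,
      by_contra fun h' => hno a (left_mem_Icc.2 hab) ⟨subset_closure ha, h'⟩⟩
    ⟨_, ⟨b, right_mem_Icc.2 hab, rfl⟩,
      fun h => hno b (right_mem_Icc.2 hab) ⟨h, fun h' => hb (interior_subset h')⟩⟩
  exact hy' (interior_subset_closure hy)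

/-- The union of the segments joining the origin to the points of `Ω`, without the origin
unless it lies in `Ω`. -/
def raySaturation (Ω : Set E) : Set E := {x | ∃ s : ℝ, 1 ≤ s ∧ s • x ∈ Ω}

lemma subset_raySaturation (Ω : Set E) : Ω ⊆ raySaturation Ω :=
  fun x hx => ⟨1, le_rfl, by simpa using hx⟩

lemma isOpen_raySaturation {Ω : Set E} (hop : IsOpen Ω) : IsOpen (raySaturation Ω) := by
  have : raySaturation Ω = ⋃ s : Ici (1 : ℝ), (fun x => (s : ℝ) • x) ⁻¹' Ω := by
    ext x
    simp [raySaturation]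
  rw [this]
  exact isOpen_iUnion fun s => hop.preimage (by fun_prop)

lemma isBounded_raySaturation {Ω : Set E} (hbd : IsBounded Ω) : IsBounded (raySaturation Ω) := by
  obtain ⟨C, hC⟩ := hbd.exists_norm_le
  refine isBounded_iff_forall_norm_le.2 ⟨C, fun x ⟨s, hs, hx⟩ => ?_⟩
  refine le_trans ?_ (hC _ hx)
  rw [norm_smul, norm_eq_abs, abs_of_pos (by linarith)]
  nlinarith [norm_nonneg x]

lemma smul_raySaturation_subset (Ω : Set E) {u : ℝ} (hu : 0 < u) (hu1 : u ≤ 1) :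
    u • raySaturation Ω ⊆ raySaturation Ω := by
  rintro _ ⟨x, ⟨s, hs, hx⟩, rfl⟩
  refine ⟨s * u⁻¹, ?_, ?_⟩
  · nlinarith [(one_le_inv₀ hu).2 hu1]
  · rw [smul_smul, mul_assoc, inv_mul_cancel₀ hu.ne', mul_one]
    exact hx

variable [MeasurableSpace E] [BorelSpace E]

lemma hausdorffMeasure_frontier_inter_ball_le [CompleteSpace E] {Ω : Set E} (hop : IsOpen Ω)
    (hconv : Convex ℝ Ω) (hne : Ω.Nonempty) {d : ℝ} (hd : 0 ≤ d) (r : ℝ) :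
    μH[d] (frontier Ω ∩ ball 0 r) ≤ μH[d] (sphere 0 r \ Ω) := by
  have hex : ∀ x : E, ∃ v : E, x ∈ frontier Ω ∩ ball 0 r →
      ‖x + v‖ = r ∧ x + v ∉ Ω ∧ ∀ y ∈ closure Ω, 0 ≤ inner ℝ v (x - y) := by
    intro x
    by_cases hx : x ∈ frontier Ω ∩ ball 0 r
    · obtain ⟨v, hv⟩ := exists_outer_normal_norm_eq hop hconv hne hx.1 (by simpa using hx.2)
      exact ⟨v, fun _ => hv⟩
    · exact ⟨0, fun h => absurd h hx⟩
  choose v hv using hex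
  refine hausdorffMeasure_le_of_dist_le hd (f := fun x => x + v x) (fun x hx => ?_)
    fun x hx y hy => ?_
  · exact ⟨by simpa using (hv x hx).1, (hv x hx).2.1⟩
  · exact dist_le_dist_add_of_inner_nonneg ((hv x hx).2.2 y hy.1.1) ((hv y hy).2.2 x hx.1.1)

lemma hausdorffMeasure_le_of_exists_smul_mem {d r : ℝ} (hd : 0 ≤ d) {S A : Set E}
    (hS : S ⊆ sphere 0 r) (h : ∀ x ∈ S, ∃ s : ℝ, 1 ≤ s ∧ s • x ∈ A) : μH[d] S ≤ μH[d] A := by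
  have hex : ∀ x : E, ∃ s : ℝ, x ∈ S → 1 ≤ s ∧ s • x ∈ A := by
    intro x
    by_cases hx : x ∈ S
    · obtain ⟨s, hs⟩ := h x hx
      exact ⟨s, fun _ => hs⟩
    · exact ⟨0, fun h => absurd h hx⟩
  choose s hs using hex
  refine hausdorffMeasure_le_of_dist_le hd (f := fun x => s x • x) (fun x hx => (hs x hx).2)
    fun x hx y hy => dist_le_dist_smul_of_norm_eq ?_ (hs x hx).1 (hs y hy).1
  rw [mem_sphere_zero_iff_norm.1 (hS hx), mem_sphere_zero_iff_norm.1 (hS hy)]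

lemma hausdorffMeasure_sphere_inter_le {Ω : Set E} (hbd : IsBounded Ω) {d r : ℝ} (hd : 0 ≤ d)
    (hr : 0 < r) : μH[d] (sphere 0 r ∩ Ω) ≤ μH[d] (frontier Ω ∩ {x | r ≤ ‖x‖}) := by
  refine hausdorffMeasure_le_of_exists_smul_mem hd inter_subset_left fun x hx => ?_
  have hxr : ‖x‖ = r := by simpa using hx.1
  obtain ⟨C, hC⟩ := hbd.exists_norm_le
  have hb : (1 + |C| / r) • x ∉ Ω := by
    intro h
    have := hC _ h
    rw [norm_smul, hxr, norm_eq_abs, abs_of_pos (by positivity), add_mul,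
      div_mul_cancel₀ _ hr.ne'] at this
    linarith [le_abs_self C]
  have h1 : 1 ≤ 1 + |C| / r := by
    have : 0 ≤ |C| / r := by positivity
    linarith
  obtain ⟨s, hs, hfr⟩ := exists_smul_mem_frontier h1 (by simpa using hx.2) hb
  refine ⟨s, hs.1, hfr, ?_⟩
  rw [mem_ofPred_eq, norm_smul, hxr, norm_eq_abs, abs_of_pos (by linarith [hs.1])]
  nlinarith [hs.1]

lemma hausdorffMeasure_sphere_inter_raySaturation_le (Ω : Set E) {d r u : ℝ} (hd : 0 ≤ d)
    (hr : 0 < r) (hu : 0 < u) :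
    μH[d] (sphere 0 r ∩ (raySaturation Ω \ u • raySaturation Ω)) ≤
      μH[d] (frontier Ω ∩ {x | r ≤ ‖x‖ ∧ u * ‖x‖ ≤ r}) := by
  refine hausdorffMeasure_le_of_exists_smul_mem hd inter_subset_left fun x hx => ?_
  have hxr : ‖x‖ = r := by simpa using hx.1
  obtain ⟨s, hs, hxs⟩ := hx.2.1
  have hnot : ∀ t, u⁻¹ ≤ t → t • x ∉ Ω := by
    intro t ht hxt
    refine hx.2.2 ⟨u⁻¹ • x, ⟨t * u, ?_, ?_⟩, smul_inv_smul₀ hu.ne' x⟩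
    · rwa [← inv_le_iff_one_le_mul₀ hu]
    · rw [smul_smul, mul_assoc, mul_inv_cancel₀ hu.ne', mul_one]
      exact hxt
  have hsu : s ≤ u⁻¹ := by
    by_contra! h
    exact hnot s h.le hxs
  obtain ⟨t, ht, hfr⟩ := exists_smul_mem_frontier hsu hxs (hnot _ le_rfl)
  have ht1 : 1 ≤ t := hs.trans ht.1
  refine ⟨t, ht1, hfr, ?_⟩
  rw [mem_ofPred_eq, norm_smul, hxr, norm_eq_abs, abs_of_pos (by linarith)]
  have htu : u * t ≤ 1 := by
    have := mul_le_mul_of_nonneg_left ht.2 hu.le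
    rwa [mul_inv_cancel₀ hu.ne'] at this
  constructor <;> nlinarith

end ConvexBoundary

section FirstMoment
open scoped ENNReal NNReal Pointwise

variable {n : ℕ}

lemma measure_add_measure_norm_lt {E : Type*} [NormedAddCommGroup E] [MeasurableSpace E]
    [BorelSpace E] (μ : Measure E) (r : ℝ) : μ {x | r ≤ ‖x‖} + μ (ball 0 r) = μ univ := by
  have h : (ball (0 : E) r) = {x | r ≤ ‖x‖}ᶜ := by
    ext x
    simp
  rw [h]
  exact measure_add_measure_compl (measurableSet_le measurable_const measurable_norm)

/-- Among bounded convex open sets of the volume of the ball of radius `R`, the mean distance of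
the boundary points to the origin is at least `R`. -/
lemma mul_measure_frontier_le_lintegral_norm (hn : 2 ≤ n)
    {κ : ℝ≥0∞} (hκ0 : κ ≠ 0) (hκt : κ ≠ ∞)
    (hκ : ∀ A : Set (EuclideanSpace ℝ (Fin n)), MeasurableSet A →
      volume A = κ * ∫⁻ r in Ioi (0 : ℝ), μH[(n : ℝ) - 1] (sphere 0 r ∩ A))
    {Ω : Set (EuclideanSpace ℝ (Fin n))} (hbd : IsBounded Ω) (hop : IsOpen Ω)
    (hconv : Convex ℝ Ω) (hne : Ω.Nonempty) {R : ℝ} (hR : 0 < R)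
    (hV : volume (ball (0 : EuclideanSpace ℝ (Fin n)) R) = volume Ω) :
    ENNReal.ofReal R * μH[(n : ℝ) - 1] (frontier Ω) ≤
      ∫⁻ x in frontier Ω, ENNReal.ofReal ‖x‖ ∂μH[(n : ℝ) - 1] := by
  have hd : (0 : ℝ) ≤ (n : ℝ) - 1 := by
    have : (2 : ℝ) ≤ n := by exact_mod_cast hn
    linarith
  have : Nonempty (Fin n) := ⟨⟨0, by omega⟩⟩
  set μ : Measure (EuclideanSpace ℝ (Fin n)) := μH[(n : ℝ) - 1]
  set ν := μ.restrict (frontier Ω)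
  set B : Set (EuclideanSpace ℝ (Fin n)) := closedBall 0 R
  have hF : Measurable fun r : ℝ => ν {x | r ≤ ‖x‖} :=
    Antitone.measurable fun r s hrs => measure_mono fun x hx => le_trans hrs hx
  have hνle : ∀ r : ℝ, ν {x | r ≤ ‖x‖} = μ (frontier Ω ∩ {x | r ≤ ‖x‖}) := fun r => by
    rw [Measure.restrict_apply (measurableSet_le measurable_const measurable_norm), inter_comm]
  have hνball : ∀ r : ℝ, ν (ball 0 r) = μ (frontier Ω ∩ ball 0 r) := fun r => by
    rw [Measure.restrict_apply measurableSet_ball, inter_comm]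
  have hvolB : volume B = volume Ω := by
    rw [← hV]
    exact Measure.addHaar_closedBall_eq_addHaar_ball _ _ _
  have hfin : volume Ω ≠ ∞ := hbd.measure_lt_top.ne
  have hdiff : volume (B \ Ω) = volume (Ω \ B) := by
    have h1 := measure_sdiff_add_inter (μ := volume) B hop.measurableSet
    have h2 := measure_sdiff_add_inter (μ := volume) Ω (measurableSet_closedBall (x := 0) (ε := R))
    rw [inter_comm, ← hvolB, ← h1] at h2
    exact ((ENNReal.add_left_inj (measure_ne_top_of_subset inter_subset_right hfin)).1 h2).symm
  have hin : κ * ∫⁻ r in Ioc 0 R, ν (ball 0 r) ≤ volume (B \ Ω) := by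
    rw [hκ _ (measurableSet_closedBall.diff hop.measurableSet)]
    gcongr κ * ?_
    calc ∫⁻ r in Ioc 0 R, ν (ball 0 r)
        ≤ ∫⁻ r in Ioc 0 R, μ (sphere 0 r ∩ (B \ Ω)) := by
          refine setLIntegral_mono' measurableSet_Ioc fun r hr => ?_
          rw [hνball]
          refine (hausdorffMeasure_frontier_inter_ball_le hop hconv hne hd r).trans ?_
          refine measure_mono fun x hx => ⟨hx.1, ?_, hx.2⟩
          exact sphere_subset_closedBall.trans (closedBall_subset_closedBall hr.2) hx.1
      _ ≤ _ := lintegral_mono_set fun r hr => hr.1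
  have hout : volume (Ω \ B) ≤ κ * ∫⁻ r in Ioi R, ν {x | r ≤ ‖x‖} := by
    rw [hκ _ (hop.measurableSet.diff measurableSet_closedBall)]
    gcongr κ * ?_
    calc ∫⁻ r in Ioi 0, μ (sphere 0 r ∩ (Ω \ B))
        ≤ ∫⁻ r in Ioi 0, (Ioi R).indicator (fun r => ν {x | r ≤ ‖x‖}) r := by
          refine setLIntegral_mono' measurableSet_Ioi fun r hr => ?_
          by_cases hrR : R < r
          · rw [indicator_of_mem (mem_Ioi.2 hrR), hνle]
            refine (measure_mono ?_).trans (hausdorffMeasure_sphere_inter_le hbd hd hr)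
            exact inter_subset_inter_right _ sdiff_subset
          · have : sphere 0 r ∩ (Ω \ B) = ∅ := by
              refine eq_empty_of_forall_notMem fun x hx => hx.2.2 ?_
              exact sphere_subset_closedBall.trans
                (closedBall_subset_closedBall (not_lt.1 hrR)) hx.1
            simp [this]
      _ ≤ ∫⁻ r, (Ioi R).indicator (fun r => ν {x | r ≤ ‖x‖}) r := setLIntegral_le_lintegral _ _
      _ = _ := lintegral_indicator measurableSet_Ioi _
  have hmain : ∫⁻ r in Ioc 0 R, ν (ball 0 r) ≤ ∫⁻ r in Ioi R, ν {x | r ≤ ‖x‖} := by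
    have := (hin.trans hdiff.le).trans hout
    rwa [ENNReal.mul_le_mul_iff_right hκ0 hκt] at this
  calc ENNReal.ofReal R * μ (frontier Ω)
      = ∫⁻ _ in Ioc 0 R, ν univ := by simp [ν, mul_comm]
    _ = ∫⁻ r in Ioc 0 R, (ν {x | r ≤ ‖x‖} + ν (ball 0 r)) := by
        simp_rw [measure_add_measure_norm_lt]
    _ = (∫⁻ r in Ioc 0 R, ν {x | r ≤ ‖x‖}) + ∫⁻ r in Ioc 0 R, ν (ball 0 r) :=
        lintegral_add_left hF _
    _ ≤ (∫⁻ r in Ioc 0 R, ν {x | r ≤ ‖x‖}) + ∫⁻ r in Ioi R, ν {x | r ≤ ‖x‖} := by gcongr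
    _ = ∫⁻ r in Ioi 0, ν {x | r ≤ ‖x‖} := by
        rw [← Ioc_union_Ioi_eq_Ioi hR.le, lintegral_union measurableSet_Ioi]
        exact Set.disjoint_left.2 fun r hr hr' => not_lt.2 hr.2 hr'
    _ = ∫⁻ x, ENNReal.ofReal ‖x‖ ∂ν :=
        (lintegral_eq_lintegral_meas_le ν (ae_of_all _ fun x => norm_nonneg x)
          measurable_norm.aemeasurable).symm

/-- The divergence theorem bound `n V(Ω) ≤ ∫ |x|` over the boundary, discretized at
the ratio `u`. -/
lemma volume_raySaturation_add_le {κ : ℝ≥0∞} (hn : 2 ≤ n)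
    (hκ : ∀ A : Set (EuclideanSpace ℝ (Fin n)), MeasurableSet A →
      volume A = κ * ∫⁻ r in Ioi (0 : ℝ), μH[(n : ℝ) - 1] (sphere 0 r ∩ A))
    {Ω : Set (EuclideanSpace ℝ (Fin n))} (hop : IsOpen Ω) {u : ℝ} (hu : 0 < u) (hu1 : u < 1) :
    volume (raySaturation Ω) +
        ENNReal.ofReal u * (κ * ∫⁻ x in frontier Ω, ENNReal.ofReal ‖x‖ ∂μH[(n : ℝ) - 1]) ≤
      ENNReal.ofReal (u ^ n) * volume (raySaturation Ω) +
        κ * ∫⁻ x in frontier Ω, ENNReal.ofReal ‖x‖ ∂μH[(n : ℝ) - 1] := by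
  have hd : (0 : ℝ) ≤ (n : ℝ) - 1 := by
    have : (2 : ℝ) ≤ n := by exact_mod_cast hn
    linarith
  set μ : Measure (EuclideanSpace ℝ (Fin n)) := μH[(n : ℝ) - 1]
  set ν := μ.restrict (frontier Ω)
  set D := raySaturation Ω
  have hDo : IsOpen D := isOpen_raySaturation hop
  have huD : MeasurableSet (u • D) := (hDo.smul₀ hu.ne').measurableSet
  set shell : ℝ → ℝ≥0∞ := fun r => ν {x | r ≤ ‖x‖ ∧ u * ‖x‖ ≤ r}
  have hshell : ∀ r, MeasurableSet {x : EuclideanSpace ℝ (Fin n) | r ≤ ‖x‖ ∧ u * ‖x‖ ≤ r} :=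
    fun r => (measurableSet_le measurable_const measurable_norm).inter
      (measurableSet_le (measurable_norm.const_mul u) measurable_const)
  have hdiff : volume (D \ u • D) ≤ κ * ∫⁻ r in Ioi 0, shell r := by
    rw [hκ _ (hDo.measurableSet.diff huD)]
    gcongr κ * ?_
    refine setLIntegral_mono' measurableSet_Ioi fun r hr => ?_
    simp only [shell, ν]
    rw [Measure.restrict_apply (hshell r), inter_comm _ (frontier Ω)]
    exact hausdorffMeasure_sphere_inter_raySaturation_le Ω hd hr hu
  have hvol : volume D = ENNReal.ofReal (u ^ n) * volume D + volume (D \ u • D) := by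
    have h := measure_inter_add_sdiff (μ := volume) D huD
    rw [inter_eq_right.2 (smul_raySaturation_subset Ω hu hu1.le),
      Measure.addHaar_smul_of_nonneg _ hu.le, finrank_euclideanSpace_fin] at h
    exact h.symm
  have hG : Measurable fun r : ℝ => ν {x | r < u * ‖x‖} :=
    Antitone.measurable fun r s hrs => measure_mono fun x hx => lt_of_le_of_lt hrs hx
  have hM : ∫⁻ x, ENNReal.ofReal ‖x‖ ∂ν =
      ENNReal.ofReal u * ∫⁻ x, ENNReal.ofReal ‖x‖ ∂ν + ∫⁻ r in Ioi 0, shell r := by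
    have h1 : ENNReal.ofReal u * ∫⁻ x, ENNReal.ofReal ‖x‖ ∂ν =
        ∫⁻ r in Ioi 0, ν {x | r < u * ‖x‖} := by
      rw [← lintegral_eq_lintegral_meas_lt ν (f := fun x => u * ‖x‖)
        (ae_of_all _ fun x => by positivity) (measurable_norm.const_mul u).aemeasurable]
      simp_rw [ENNReal.ofReal_mul hu.le]
      rw [lintegral_const_mul' _ _ ENNReal.ofReal_ne_top]
    rw [h1, ← lintegral_add_left hG, lintegral_eq_lintegral_meas_le ν
      (ae_of_all _ fun x => norm_nonneg x) measurable_norm.aemeasurable]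
    refine setLIntegral_congr_fun measurableSet_Ioi fun r hr => ?_
    have hr0 : (0 : ℝ) < r := hr
    have hsplit : {x : EuclideanSpace ℝ (Fin n) | r ≤ ‖x‖} =
        {x | r < u * ‖x‖} ∪ {x | r ≤ ‖x‖ ∧ u * ‖x‖ ≤ r} := by
      ext x
      simp only [mem_ofPred_eq, mem_union]
      constructor
      · intro h
        by_cases h' : r < u * ‖x‖
        · exact Or.inl h'
        · exact Or.inr ⟨h, not_lt.1 h'⟩
      · rintro (h | h)
        · nlinarith [norm_nonneg x]
        · exact h.1
    simp only [hsplit, shell]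
    refine measure_union (Set.disjoint_left.2 fun x hx hx' => ?_) (hshell r)
    exact not_lt.2 hx'.2 hx
  calc volume D + ENNReal.ofReal u * (κ * ∫⁻ x, ENNReal.ofReal ‖x‖ ∂ν)
      ≤ ENNReal.ofReal (u ^ n) * volume D + κ * (∫⁻ r in Ioi 0, shell r) +
          ENNReal.ofReal u * (κ * ∫⁻ x, ENNReal.ofReal ‖x‖ ∂ν) := by
        gcongr
        exact hvol.le.trans (by gcongr)
    _ = ENNReal.ofReal (u ^ n) * volume D + κ * (ENNReal.ofReal u *
          (∫⁻ x, ENNReal.ofReal ‖x‖ ∂ν) + ∫⁻ r in Ioi 0, shell r) := by ring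
    _ = _ := by rw [← hM]

/-- A consequence of the divergence theorem: `n V(Ω)` is at most the integral of `|x|` over the
boundary. The constant `κ` accounts for the normalization of the Hausdorff measure. -/
lemma mul_volume_le_lintegral_norm {κ : ℝ≥0∞} (hn : 2 ≤ n)
    (hκ : ∀ A : Set (EuclideanSpace ℝ (Fin n)), MeasurableSet A →
      volume A = κ * ∫⁻ r in Ioi (0 : ℝ), μH[(n : ℝ) - 1] (sphere 0 r ∩ A))
    {Ω : Set (EuclideanSpace ℝ (Fin n))} (hbd : IsBounded Ω) (hop : IsOpen Ω) :
    n * volume Ω ≤ κ * ∫⁻ x in frontier Ω, ENNReal.ofReal ‖x‖ ∂μH[(n : ℝ) - 1] := by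
  rcases eq_or_ne (κ * ∫⁻ x in frontier Ω, ENNReal.ofReal ‖x‖ ∂μH[(n : ℝ) - 1]) ∞ with hM | hM
  · rw [hM]
    exact le_top
  have hu := fun u h0 h1 => volume_raySaturation_add_le (u := u) hn hκ hop h0 h1
  set M := κ * ∫⁻ x in frontier Ω, ENNReal.ofReal ‖x‖ ∂μH[(n : ℝ) - 1]
  have hD : volume (raySaturation Ω) ≠ ∞ := (isBounded_raySaturation hbd).measure_lt_top.ne
  set v := (volume (raySaturation Ω)).toReal
  have hreal : ∀ u : ℝ, 0 < u → u < 1 → v * ∑ i ∈ Finset.range n, u ^ i ≤ M.toReal := by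
    intro u h0 h1
    have h := hu u h0 h1
    rw [← ENNReal.ofReal_toReal hM, ← ENNReal.ofReal_toReal hD, ← ENNReal.ofReal_mul h0.le,
      ← ENNReal.ofReal_mul (by positivity), ← ENNReal.ofReal_add (by positivity) (by positivity),
      ← ENNReal.ofReal_add (by positivity) (by positivity),
      ENNReal.ofReal_le_ofReal_iff (by positivity)] at h
    have hgeom := mul_neg_geom_sum u n
    refine le_of_mul_le_mul_left ?_ (sub_pos.2 h1)
    calc (1 - u) * (v * ∑ i ∈ Finset.range n, u ^ i)
        = v * ((1 - u) * ∑ i ∈ Finset.range n, u ^ i) := by ring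
      _ = v * (1 - u ^ n) := by rw [hgeom]
      _ ≤ (1 - u) * M.toReal := by linarith
  have hlim : v * n ≤ M.toReal := by
    have hcont : Filter.Tendsto (fun u : ℝ => v * ∑ i ∈ Finset.range n, u ^ i)
        (nhdsWithin 1 (Iio 1)) (nhds (v * ∑ i ∈ Finset.range n, (1 : ℝ) ^ i)) :=
      (Continuous.tendsto (by fun_prop) 1).mono_left nhdsWithin_le_nhds
    have := le_of_tendsto hcont (by
      filter_upwards [Ioo_mem_nhdsLT (zero_lt_one (α := ℝ))] with u hu
      exact hreal u hu.1 hu.2)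
    simpa using this
  calc (n : ℝ≥0∞) * volume Ω ≤ n * volume (raySaturation Ω) := by
        gcongr
        exact subset_raySaturation Ω
    _ = ENNReal.ofReal (v * n) := by
        rw [mul_comm v, ENNReal.ofReal_mul (by positivity), ENNReal.ofReal_toReal hD,
          ENNReal.ofReal_natCast]
    _ ≤ ENNReal.ofReal M.toReal := ENNReal.ofReal_le_ofReal hlim
    _ = M := ENNReal.ofReal_toReal hM

end FirstMoment

section Momentum
open scoped ENNReal NNReal

variable {n : ℕ}

lemma hausdorffMeasure_sphere (hn : 1 ≤ n) {r : ℝ} (hr : 0 < r) :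
    μH[(n : ℝ) - 1] (sphere (0 : EuclideanSpace ℝ (Fin n)) r) =
      ENNReal.ofReal (r ^ (n - 1)) *
        μH[(n : ℝ) - 1] (sphere (0 : EuclideanSpace ℝ (Fin n)) 1) := by
  have h1 := hausdorffMeasure_sphere_inter n one_pos hn univ
  have h2 := hausdorffMeasure_sphere_inter n hr hn univ
  simp only [inter_univ, one_pow, ENNReal.ofReal_one, one_mul, mem_univ] at h1 h2
  rw [h1, h2]

lemma hausdorffMeasure_sphere_ne_top (hn : 1 ≤ n) {r : ℝ} (hr : 0 < r) :
    μH[(n : ℝ) - 1] (sphere (0 : EuclideanSpace ℝ (Fin n)) r) ≠ ∞ := by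
  obtain ⟨m, rfl⟩ : ∃ m, n = m + 1 := ⟨n - 1, by omega⟩
  rw [hausdorffMeasure_sphere hn hr]
  refine ENNReal.mul_ne_top ENNReal.ofReal_ne_top ?_
  have h := hausdorffMeasure_sphere_lt_top m
  rwa [show (m : ℝ) = ((m + 1 : ℕ) : ℝ) - 1 by push_cast; ring, lt_top_iff_ne_top] at h

lemma hausdorffMeasure_sphere_ne_zero (hn : 1 ≤ n) {r : ℝ} (hr : 0 < r) :
    μH[(n : ℝ) - 1] (sphere (0 : EuclideanSpace ℝ (Fin n)) r) ≠ 0 := by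
  obtain ⟨m, rfl⟩ : ∃ m, n = m + 1 := ⟨n - 1, by omega⟩
  rw [hausdorffMeasure_sphere hn hr]
  refine mul_ne_zero (by simpa using pow_pos hr _) ?_
  have h := hausdorffMeasure_sphere_pos m
  rw [show (m : ℝ) = ((m + 1 : ℕ) : ℝ) - 1 by push_cast; ring] at h
  exact h.ne'

lemma mul_hausdorffMeasure_sphere_le (hn : 2 ≤ n) {κ : ℝ≥0∞}
    (hκ : ∀ A : Set (EuclideanSpace ℝ (Fin n)), MeasurableSet A →
      volume A = κ * ∫⁻ r in Ioi (0 : ℝ), μH[(n : ℝ) - 1] (sphere 0 r ∩ A))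
    {R : ℝ} (hR : 0 < R) :
    κ * (ENNReal.ofReal R * μH[(n : ℝ) - 1] (sphere (0 : EuclideanSpace ℝ (Fin n)) R)) ≤
      n * volume (ball (0 : EuclideanSpace ℝ (Fin n)) R) := by
  have hn1 : 1 ≤ n := by omega
  set s := μH[(n : ℝ) - 1] (sphere (0 : EuclideanSpace ℝ (Fin n)) 1)
  have hint : ∫⁻ r in Ioo 0 R, ENNReal.ofReal (r ^ (n - 1)) = ENNReal.ofReal (R ^ n / n) := by
    rw [← ofReal_integral_eq_lintegral_ofReal, ← integral_Ioc_eq_integral_Ioo,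
      ← intervalIntegral.integral_of_le hR.le, integral_pow]
    · have : ((n - 1 : ℕ) : ℝ) + 1 = n := by
        rw [Nat.cast_sub hn1]; simp
      rw [this, Nat.sub_add_cancel hn1, zero_pow (by omega), sub_zero]
    · exact ((continuous_pow _).integrableOn_Icc (a := 0) (b := R)).mono_set Ioo_subset_Icc_self
    · exact (ae_restrict_mem measurableSet_Ioo).mono fun r hr => pow_nonneg hr.1.le _
  have hlow : s * ENNReal.ofReal (R ^ n / n) ≤
      ∫⁻ r in Ioi (0 : ℝ),
        μH[(n : ℝ) - 1] (sphere 0 r ∩ ball (0 : EuclideanSpace ℝ (Fin n)) R) := by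
    rw [← hint, ← lintegral_const_mul' _ _ (hausdorffMeasure_sphere_ne_top hn1 one_pos)]
    calc ∫⁻ r in Ioo 0 R, s * ENNReal.ofReal (r ^ (n - 1))
        ≤ ∫⁻ r in Ioo 0 R,
            μH[(n : ℝ) - 1] (sphere 0 r ∩ ball (0 : EuclideanSpace ℝ (Fin n)) R) := by
          refine setLIntegral_mono' measurableSet_Ioo fun r hr => ?_
          rw [inter_eq_left.2 (sphere_subset_closedBall.trans (closedBall_subset_ball hr.2)),
            hausdorffMeasure_sphere hn1 hr.1, mul_comm]
      _ ≤ _ := lintegral_mono_set Ioo_subset_Ioi_self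
  rw [hκ _ measurableSet_ball, hausdorffMeasure_sphere hn1 hR, mul_left_comm (n : ℝ≥0∞)]
  gcongr κ * ?_
  refine le_trans (le_of_eq ?_) (mul_le_mul_right hlow _)
  have hreal : R * R ^ (n - 1) = n * (R ^ n / n) := by
    have : (n : ℝ) ≠ 0 := by positivity
    rw [mul_div_cancel₀ _ this, ← pow_succ', Nat.sub_add_cancel hn1]
  rw [mul_left_comm (n : ℝ≥0∞), ← ENNReal.ofReal_natCast n, ← ENNReal.ofReal_mul (by positivity),
    ← hreal, ENNReal.ofReal_mul hR.le]
  ring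

lemma hausdorffMeasure_frontier_ne_top (hn : 1 ≤ n)
    {Ω : Set (EuclideanSpace ℝ (Fin n))} (hbd : IsBounded Ω) (hop : IsOpen Ω)
    (hconv : Convex ℝ Ω) (hne : Ω.Nonempty) : μH[(n : ℝ) - 1] (frontier Ω) ≠ ∞ := by
  have hd : (0 : ℝ) ≤ (n : ℝ) - 1 := by
    have : (1 : ℝ) ≤ n := by exact_mod_cast hn
    linarith
  obtain ⟨r, hr, hsub⟩ := hbd.closure.subset_ball_lt 0 0
  have h := hausdorffMeasure_frontier_inter_ball_le hop hconv hne hd r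
  rw [inter_eq_left.2 (frontier_subset_closure.trans hsub)] at h
  exact ne_top_of_le_ne_top (hausdorffMeasure_sphere_ne_top hn hr)
    (h.trans (measure_mono sdiff_subset))

lemma perim_ball_pos (hn : 1 ≤ n) {R : ℝ} (hR : 0 < R) : 0 < perim n (ball 0 R) := by
  have : Nonempty (Fin n) := ⟨⟨0, by omega⟩⟩
  rw [perim, frontier_ball _ hR.ne']
  exact ENNReal.toReal_pos (hausdorffMeasure_sphere_ne_zero hn hR)
    (hausdorffMeasure_sphere_ne_top hn hR)

lemma bmom_ball {R : ℝ} (hR : 0 < R) : bmom n (ball 0 R) = R ^ 2 * perim n (ball 0 R) := by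
  have h : EqOn (fun x : EuclideanSpace ℝ (Fin n) => ‖x‖ ^ 2) (fun _ => R ^ 2)
      (frontier (ball 0 R)) := fun x hx => by
    rw [frontier_ball _ hR.ne'] at hx
    simp [mem_sphere_zero_iff_norm.1 hx]
  rw [bmom, setIntegral_congr_fun isClosed_frontier.measurableSet h, setIntegral_const, perim,
    smul_eq_mul, mul_comm, measureReal_def]

/-- The boundary momentum of a bounded convex open set is at least `R ^ 2` times its perimeter and
at least the boundary momentum of the centered ball of radius `R` and of the same volume. -/
lemma sq_mul_max_perim_le_bmom (hn : 2 ≤ n)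
    {Ω : Set (EuclideanSpace ℝ (Fin n))} (hbd : IsBounded Ω) (hop : IsOpen Ω)
    (hconv : Convex ℝ Ω) (hne : Ω.Nonempty) {R : ℝ} (hR : 0 < R)
    (hV : volume (ball (0 : EuclideanSpace ℝ (Fin n)) R) = volume Ω) :
    R ^ 2 * max (perim n Ω) (perim n (ball 0 R)) ≤ bmom n Ω := by
  have hn1 : 1 ≤ n := by omega
  have : Nonempty (Fin n) := ⟨⟨0, by omega⟩⟩
  obtain ⟨κ, hκ0, hκt, hκ⟩ := exists_volume_eq_mul_lintegral_hausdorffMeasure_sphere n hn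
  have hfin := hausdorffMeasure_frontier_ne_top hn1 hbd hop hconv hne
  have h1 := mul_measure_frontier_le_lintegral_norm hn hκ0 hκt hκ hbd hop hconv hne hR hV
  have h2 := (mul_hausdorffMeasure_sphere_le hn hκ hR).trans
    (hV ▸ mul_volume_le_lintegral_norm hn hκ hbd hop)
  rw [ENNReal.mul_le_mul_iff_right hκ0 hκt] at h2
  obtain ⟨C, hC⟩ := hbd.closure.exists_norm_le
  have hint : ∀ k : ℕ, IntegrableOn (fun x : EuclideanSpace ℝ (Fin n) => ‖x‖ ^ k) (frontier Ω)
      μH[(n : ℝ) - 1] := fun k => by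
    refine Measure.integrableOn_of_bounded (M := C ^ k) hfin
      (continuous_norm.pow k).aestronglyMeasurable ?_
    filter_upwards [ae_restrict_mem isClosed_frontier.measurableSet] with x hx
    rw [norm_pow, norm_norm]
    exact pow_le_pow_left₀ (norm_nonneg _) (hC x (frontier_subset_closure hx)) k
  have hint1 : IntegrableOn (fun x : EuclideanSpace ℝ (Fin n) => ‖x‖) (frontier Ω)
      μH[(n : ℝ) - 1] := by simpa using hint 1
  rw [← ofReal_integral_eq_lintegral_ofReal hint1 (ae_of_all _ norm_nonneg)] at h1 h2
  set M := ∫ x in frontier Ω, ‖x‖ ∂μH[(n : ℝ) - 1]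
  have hM0 : 0 ≤ M := integral_nonneg fun _ => norm_nonneg _
  have hP : R * perim n Ω ≤ M := by
    have := ENNReal.toReal_mono ENNReal.ofReal_ne_top h1
    rwa [ENNReal.toReal_mul, ENNReal.toReal_ofReal hR.le, ENNReal.toReal_ofReal hM0] at this
  have hB : R * perim n (ball 0 R) ≤ M := by
    have := ENNReal.toReal_mono ENNReal.ofReal_ne_top h2
    rwa [ENNReal.toReal_mul, ENNReal.toReal_ofReal hR.le, ENNReal.toReal_ofReal hM0,
      ← frontier_ball _ hR.ne'] at this
  have hW : 2 * R * M - R ^ 2 * perim n Ω ≤ bmom n Ω := by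
    have hc : IntegrableOn (fun _ : EuclideanSpace ℝ (Fin n) => R ^ 2) (frontier Ω)
        μH[(n : ℝ) - 1] := integrableOn_const hfin
    calc 2 * R * M - R ^ 2 * perim n Ω
        = ∫ x in frontier Ω, (2 * R * ‖x‖ - R ^ 2) ∂μH[(n : ℝ) - 1] := by
          rw [integral_sub (hint1.const_mul _) hc, integral_const_mul, setIntegral_const,
            measureReal_def, smul_eq_mul, mul_comm (R ^ 2), perim]
      _ ≤ bmom n Ω := integral_mono ((hint1.const_mul _).sub hc) (hint 2)
          fun x => by
            simp only
            nlinarith [sq_nonneg (‖x‖ - R)]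
  rw [mul_max_of_nonneg _ _ (sq_nonneg R), max_le_iff]
  constructor <;> nlinarith

end Momentum

/-- for `β ≥ 0`, the Wentzell upper-bound functional
`(n V(Ω) + β P(Ω)) / W(Ω)` is maximal on the ball `B` centered at the origin with
`V(B) = V(Ω)`; explicitly it is bounded by
`ω_n^{2/n} (n V(Ω)^{(n-2)/n} / P(B) + β V(Ω)^{-2/n})`. -/
theorem wentzell_geometric_inequality (n : ℕ) (hn : 2 ≤ n) (β : ℝ) (hβ : 0 ≤ β)
    (Ω : Set (EuclideanSpace ℝ (Fin n)))
    (hbd : IsBounded Ω) (hop : IsOpen Ω) (hconv : Convex ℝ Ω)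
    (hint : (interior Ω).Nonempty)
    (R : ℝ) (hR : 0 < R)
    (hV : vol n (ball (0 : EuclideanSpace ℝ (Fin n)) R) = vol n Ω) :
    ((n : ℝ) * vol n Ω + β * perim n Ω) / bmom n Ω ≤
      ((n : ℝ) * vol n (ball (0 : EuclideanSpace ℝ (Fin n)) R) +
        β * perim n (ball (0 : EuclideanSpace ℝ (Fin n)) R)) /
        bmom n (ball (0 : EuclideanSpace ℝ (Fin n)) R) ∧
    ((n : ℝ) * vol n Ω + β * perim n Ω) / bmom n Ω ≤
      unitBallVol n ^ ((2 : ℝ) / n) *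
        ((n : ℝ) * vol n Ω ^ (((n : ℝ) - 2) / n) /
            perim n (ball (0 : EuclideanSpace ℝ (Fin n)) R) +
          β * vol n Ω ^ (-(2 : ℝ) / n)) := by
  have hn1 : 1 ≤ n := by omega
  have hn0 : (0 : ℝ) < n := by positivity
  have hV' : volume (ball (0 : EuclideanSpace ℝ (Fin n)) R) = volume Ω :=
    (ENNReal.toReal_eq_toReal_iff' measure_ball_lt_top.ne hbd.measure_lt_top.ne).1 hV
  have hW := sq_mul_max_perim_le_bmom hn hbd hop hconv (hint.mono interior_subset) hR hV'
  rw [mul_max_of_nonneg _ _ (sq_nonneg R), max_le_iff] at hW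
  have hB := perim_ball_pos hn1 hR
  have hR2 : 0 < R ^ 2 := by positivity
  have hWpos : 0 < bmom n Ω := (mul_pos hR2 hB).trans_le hW.2
  have hvol0 : 0 ≤ vol n Ω := ENNReal.toReal_nonneg
  have hmain : ((n : ℝ) * vol n Ω + β * perim n Ω) / bmom n Ω ≤
      n * vol n Ω / (R ^ 2 * perim n (ball 0 R)) + β / R ^ 2 := by
    rw [add_div]
    refine add_le_add (div_le_div_of_nonneg_left (by positivity) (by positivity) hW.2) ?_
    rw [div_le_div_iff₀ hWpos hR2]
    nlinarith [mul_le_mul_of_nonneg_left hW.1 hβ]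
  have hω : 0 < unitBallVol n :=
    ENNReal.toReal_pos (measure_ball_pos _ _ one_pos).ne' measure_ball_lt_top.ne
  have hvol : vol n Ω = R ^ n * unitBallVol n := by
    rw [← hV, vol, unitBallVol, Measure.addHaar_ball_of_pos _ _ hR, ENNReal.toReal_mul,
      ENNReal.toReal_ofReal (by positivity), finrank_euclideanSpace_fin]
  have hpow : unitBallVol n ^ ((2 : ℝ) / n) * vol n Ω ^ (-(2 : ℝ) / n) = (R ^ 2)⁻¹ := by
    rw [hvol, mul_rpow (by positivity) hω.le, mul_left_comm, ← rpow_add hω,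
      ← rpow_natCast R n, ← rpow_mul hR.le]
    rw [show (2 : ℝ) / n + -2 / n = 0 by ring, show (n : ℝ) * (-2 / n) = -2 by field_simp,
      rpow_zero, mul_one, rpow_neg hR.le, rpow_two]
  have hpow' : vol n Ω ^ (((n : ℝ) - 2) / n) = vol n Ω * vol n Ω ^ (-(2 : ℝ) / n) := by
    have hpos : 0 < vol n Ω := by rw [hvol]; positivity
    rw [show ((n : ℝ) - 2) / n = 1 + -2 / n by field_simp; ring, rpow_add hpos, rpow_one]
  refine ⟨hmain.trans_eq ?_, hmain.trans_eq ?_⟩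
  · rw [bmom_ball hR, hV]
    field_simp
  · rw [hpow', show ∀ a b p v w : ℝ, a * (n * (v * w) / p + b * w) = (a * w) * (n * v / p + b)
      by intros; ring, hpow]
    field_simp
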